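/- arXiv:2006.16246 — 6 statements merged into one kernel-verified Lean document; each statement's English description precedes it below -/
import Mathlib

section
/- Let T : ℝ² → [0,1] be measurable with T(−p_x, p_y) = T(p_x, p_y) for all p, and set R = 1 − T. Fix τ > 0, j ∈ ℝ, ρ¹, ρ² ∈ ℝ, A ∈ ℝ, and define G(p) = (2/(τ v_F²)) L_A(p) v_x(p) j. Suppose θ¹, θ² : ℝ² → ℝ are measurable with v_x θ¹, v_x θ², v_x² θ¹ integrable, and satisfy: (i) the albedo ansatz θ¹(p) = ρ¹ L_A(p) for p_x > 0 and θ²(p) = ρ² L_A(p) for p_x < 0; (ii) the zero-flux conditions ∫_{ℝ²} v_x(p) θ¹(p) dp = 0 and ∫_{ℝ²} v_x(p) θ²(p) dp = 0; (iii) the transmission condition θ¹(p) − G(p) = R(p)[θ¹(∼p) − G(∼p)] + T(p)[θ²(p) − G(p)] for almost every p with p_x < 0; and (iv) ∫_{p_x>0} T(p) L_A(p) v_x(p) dp ≠ 0. Then ρ² − ρ¹ = (j/τ) · ϑ, where ϑ = (2/v_F) · [ h²/2 − 2 ∫_{p_x>0} T(p) L_A(p) (p_x/|p|)² dp ] / [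 ∫_{p_x>0} T(p) L_A(p) (p_x/|p|) dp ] is the interpolation coefficient. -/
open MeasureTheory Real Set Filter

noncomputable section

/-- Euclidean norm of `p ∈ ℝ²` (realized as `ℝ × ℝ`). -/
def pnorm (p : ℝ × ℝ) : ℝ := Real.sqrt (p.1 ^ 2 + p.2 ^ 2)

/-- `x`-component of the semiclassical velocity `v(p) = v_F p/|p|`. -/
def vx (vF : ℝ) (p : ℝ × ℝ) : ℝ := vF * p.1 / pnorm p

/-- Fermi integral of order `k`. -/
def fermiInt (k z : ℝ) : ℝ :=
  (1 / Real.Gamma k) * ∫ t in Set.Ioi (0 : ℝ), t ^ (k - 1) / (Real.exp (t - z) + 1)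

/-- The constant `n₀ = 2π/(β h v_F)²`. -/
def n0 (β vF h : ℝ) : ℝ := 2 * Real.pi / (β * h * vF) ^ 2

/-- Fermi–Dirac distribution with chemical potential `A`. -/
def FD (β vF A : ℝ) (p : ℝ × ℝ) : ℝ := 1 / (Real.exp (β * (vF * pnorm p - A)) + 1)

/-- Linearized Fermi–Dirac distribution. -/
def LFD (β vF h A : ℝ) (p : ℝ × ℝ) : ℝ :=
  (FD β vF A p) ^ 2 * Real.exp (β * (vF * pnorm p - A)) / (n0 β vF h * fermiInt 1 (β * A))

/-- The source term `G(p) = (2/(τ v_F²)) L_A(p) v_x(p) j`. -/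
def Gfun (β vF h τ j A : ℝ) (p : ℝ × ℝ) : ℝ :=
  (2 / (τ * vF ^ 2)) * LFD β vF h A p * vx vF p * j

/-- Reflection in the first coordinate preserves Lebesgue measure on the plane. -/
lemma measurePreserving_reflect :
    MeasurePreserving (fun p : ℝ × ℝ => ((-p.1, p.2) : ℝ × ℝ)) volume volume :=
  (Measure.measurePreserving_neg (volume : Measure ℝ)).prod (MeasurePreserving.id volume)

lemma measurableEmbedding_reflect :
    MeasurableEmbedding (fun p : ℝ × ℝ => ((-p.1, p.2) : ℝ × ℝ)) :=
  ((MeasurableEquiv.neg ℝ).prodCongr (MeasurableEquiv.refl ℝ)).measurableEmbedding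

lemma measurableSet_right_half : MeasurableSet {p : ℝ × ℝ | 0 < p.1} :=
  measurableSet_lt measurable_const measurable_fst

lemma volume_fst_eq_zero : volume {p : ℝ × ℝ | p.1 = 0} = 0 := by
  have h : {p : ℝ × ℝ | p.1 = 0} = ({0} : Set ℝ) ×ˢ (univ : Set ℝ) := by
    ext p; simp
  rw [h, Measure.volume_eq_prod, Measure.prod_prod]
  simp

/-- Folding an integral over the plane onto the right half-plane. -/
lemma integral_eq_setIntegral_add_reflect {f : ℝ × ℝ → ℝ} (hf : Integrable f) :
    ∫ p, f p = ∫ p in {p : ℝ × ℝ | 0 < p.1}, (f p + f (-p.1, p.2)) := by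
  have hf' : Integrable (fun p : ℝ × ℝ => f (-p.1, p.2)) :=
    (measurePreserving_reflect.integrable_comp_emb measurableEmbedding_reflect).2 hf
  rw [integral_add hf.integrableOn hf'.integrableOn,
    ← integral_add_compl measurableSet_right_half hf]
  congr 1
  have hpre : {p : ℝ × ℝ | 0 < p.1} =
      (fun p : ℝ × ℝ => ((-p.1, p.2) : ℝ × ℝ)) ⁻¹' {p : ℝ × ℝ | p.1 < 0} := by
    ext p; simp
  rw [hpre, measurePreserving_reflect.setIntegral_preimage_emb measurableEmbedding_reflect f,
    ← hpre]
  apply setIntegral_congr_set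
  have hne : ∀ᵐ p : ℝ × ℝ, p.1 ≠ 0 := by
    rw [ae_iff]
    simpa using volume_fst_eq_zero
  filter_upwards [hne] with p hp
  apply propext
  change ¬ (0 < p.1) ↔ p.1 < 0
  rw [not_lt]
  exact ⟨fun h => lt_of_le_of_ne h hp, le_of_lt⟩

lemma hasDerivAt_neg_log_one_add_exp (b a r : ℝ) :
    HasDerivAt (fun r => -log (1 + exp (a - b * r))) (b / (exp (b * r - a) + 1)) r := by
  have h1 : HasDerivAt (fun r : ℝ => a - b * r) (-b) r := by
    simpa using ((hasDerivAt_id r).const_mul b).const_sub a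
  have h2 := ((h1.exp.const_add 1).log (by positivity)).neg
  refine h2.congr_deriv ?_
  have h3 : exp (b * r - a) = (exp (a - b * r))⁻¹ := by
    rw [← exp_neg]; congr 1; ring
  rw [h3]
  have := exp_pos (a - b * r)
  field_simp

lemma tendsto_log_one_add_exp {b : ℝ} (hb : 0 < b) (a : ℝ) :
    Tendsto (fun r => -log (1 + exp (a - b * r))) atTop (nhds 0) := by
  have h1 : Tendsto (fun r : ℝ => a - b * r) atTop atBot := by
    have := tendsto_neg_atTop_atBot.comp (tendsto_id.const_mul_atTop hb)
    simpa [sub_eq_add_neg] using tendsto_atBot_add_const_left atTop a this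
  have h2 := ((tendsto_exp_atBot.comp h1).const_add 1)
  have h3 := (h2.log (by norm_num)).neg
  simpa using h3

/-- The Fermi integral of order one in closed form. -/
lemma fermiInt_one (z : ℝ) : fermiInt 1 z = log (1 + exp z) := by
  have h := integral_Ioi_of_hasDerivAt_of_nonneg' (a := 0)
    (fun r _ => hasDerivAt_neg_log_one_add_exp 1 z r)
    (fun r _ => by positivity) (tendsto_log_one_add_exp one_pos z)
  simpa [fermiInt] using h

lemma fermiInt_one_pos (z : ℝ) : 0 < fermiInt 1 z := by
  rw [fermiInt_one]
  exact log_pos (by linarith [exp_pos z])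

/-- The radial integral behind the normalization of the linearized distribution. -/
lemma integral_radial {b : ℝ} (hb : 0 < b) (a : ℝ) :
    ∫ r in Ioi (0 : ℝ), r * ((1 / (exp (b * r - a) + 1)) ^ 2 * exp (b * r - a)) =
      fermiInt 1 a / b ^ 2 := by
  have hd : ∀ r ∈ Ici (0 : ℝ), HasDerivAt
      (fun r => -(r * (1 / (exp (b * r - a) + 1))) / b + -log (1 + exp (a - b * r)) / b ^ 2)
      (r * ((1 / (exp (b * r - a) + 1)) ^ 2 * exp (b * r - a))) r := by
    intro r _
    have h1 : HasDerivAt (fun r : ℝ => b * r - a) b r := by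
      simpa using ((hasDerivAt_id r).const_mul b).sub_const a
    have h2 := (h1.exp.add_const 1).inv (by positivity)
    have h3 := (((hasDerivAt_id r).mul h2).neg.div_const b).add
      ((hasDerivAt_neg_log_one_add_exp b a r).div_const (b ^ 2))
    have := exp_pos (b * r - a)
    refine (h3.congr_of_eventuallyEq (Eventually.of_forall fun x => ?_)).congr_deriv ?_
    · simp
    · simp only [id, Pi.inv_apply]
      field_simp
      ring
  have hlim : Tendsto
      (fun r => -(r * (1 / (exp (b * r - a) + 1))) / b + -log (1 + exp (a - b * r)) / b ^ 2)
      atTop (nhds 0) := by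
    have h1 : Tendsto (fun r : ℝ => r * (1 / (exp (b * r - a) + 1))) atTop (nhds 0) := by
      have h2 := (tendsto_rpow_mul_exp_neg_mul_atTop_nhds_zero 1 b hb).mul_const (exp a)
      rw [zero_mul] at h2
      refine tendsto_of_tendsto_of_tendsto_of_le_of_le' tendsto_const_nhds h2 ?_ ?_
      · filter_upwards [eventually_ge_atTop 0] with r hr
        positivity
      · filter_upwards [eventually_ge_atTop 0] with r hr
        rw [rpow_one, mul_assoc, ← exp_add]
        apply mul_le_mul_of_nonneg_left _ hr
        have h3 : exp (-b * r + a) = 1 / exp (b * r - a) := by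
          rw [one_div, ← exp_neg]; congr 1; ring
        rw [h3]
        exact one_div_le_one_div_of_le (exp_pos _) (by linarith)
    simpa using (h1.neg.div_const b).add ((tendsto_log_one_add_exp hb a).div_const (b ^ 2))
  rw [integral_Ioi_of_hasDerivAt_of_nonneg' hd
    (fun r hr => by have : 0 < r := hr; positivity) hlim, fermiInt_one]
  simp
  ring

lemma n0_pos {β vF h : ℝ} (hβ : 0 < β) (hvF : 0 < vF) (hh : 0 < h) : 0 < n0 β vF h := by
  unfold n0; positivity

lemma LFD_nonneg {β vF h : ℝ} (hβ : 0 < β) (hvF : 0 < vF) (hh : 0 < h) (A : ℝ) (p : ℝ × ℝ) :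
    0 ≤ LFD β vF h A p := by
  have := n0_pos hβ hvF hh
  have := fermiInt_one_pos (β * A)
  unfold LFD
  positivity

lemma pnorm_polarCoord_symm {q : ℝ × ℝ} (hq : 0 < q.1) : pnorm (polarCoord.symm q) = q.1 := by
  have h : (q.1 * cos q.2) ^ 2 + (q.1 * sin q.2) ^ 2 = q.1 ^ 2 := by
    linear_combination q.1 ^ 2 * sin_sq_add_cos_sq q.2
  simp only [pnorm, polarCoord_symm_apply, h]
  exact sqrt_sq hq.le

lemma integral_Ioo_cos_sq : ∫ t in Ioo (-π) π, cos t ^ 2 = π := by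
  rw [← integral_Ioc_eq_integral_Ioo,
    ← intervalIntegral.integral_of_le (by linarith [pi_pos]), integral_cos_sq]
  simp

/-- Second angular moment of the linearized Fermi–Dirac distribution. -/
lemma integral_LFD_mul_cos_sq {β vF h : ℝ} (hβ : 0 < β) (hvF : 0 < vF) (hh : 0 < h) (A : ℝ) :
    ∫ p : ℝ × ℝ, LFD β vF h A p * (p.1 / pnorm p) ^ 2 = h ^ 2 / 2 := by
  rw [← integral_comp_polarCoord_symm]
  have hpol : ∀ q ∈ polarCoord.target,
      q.1 • (LFD β vF h A (polarCoord.symm q) *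
        ((polarCoord.symm q).1 / pnorm (polarCoord.symm q)) ^ 2) =
      (q.1 * ((1 / (exp (β * vF * q.1 - β * A) + 1)) ^ 2 * exp (β * vF * q.1 - β * A))) *
        (cos q.2 ^ 2 / (n0 β vF h * fermiInt 1 (β * A))) := by
    intro q hq
    have hq1 : 0 < q.1 := hq.1
    have he : β * (vF * q.1 - A) = β * vF * q.1 - β * A := by ring
    have hc : (polarCoord.symm q).1 / q.1 = cos q.2 := by
      rw [polarCoord_symm_apply]
      field_simp
    simp only [LFD, FD, pnorm_polarCoord_symm hq1, he, hc, smul_eq_mul]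
    ring
  rw [setIntegral_congr_fun polarCoord.open_target.measurableSet hpol, polarCoord_target,
    Measure.volume_eq_prod, setIntegral_prod_mul
      (fun r => r * ((1 / (exp (β * vF * r - β * A) + 1)) ^ 2 * exp (β * vF * r - β * A)))
      (fun t => cos t ^ 2 / (n0 β vF h * fermiInt 1 (β * A))),
    integral_radial (mul_pos hβ hvF), integral_div, integral_Ioo_cos_sq]
  have := fermiInt_one_pos (β * A)
  have := pi_pos
  unfold n0
  field_simp

lemma integrable_LFD_mul_cos_sq {β vF h : ℝ} (hβ : 0 < β) (hvF : 0 < vF) (hh : 0 < h) (A : ℝ) :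
    Integrable (fun p : ℝ × ℝ => LFD β vF h A p * (p.1 / pnorm p) ^ 2) := by
  apply Integrable.of_integral_ne_zero
  rw [integral_LFD_mul_cos_sq hβ hvF hh]
  positivity

lemma pnorm_reflect (p : ℝ × ℝ) : pnorm (-p.1, p.2) = pnorm p := by simp [pnorm]

lemma LFD_reflect (β vF h A : ℝ) (p : ℝ × ℝ) : LFD β vF h A (-p.1, p.2) = LFD β vF h A p := by
  simp only [LFD, FD, pnorm_reflect]

lemma vx_reflect (vF : ℝ) (p : ℝ × ℝ) : vx vF (-p.1, p.2) = -vx vF p := by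
  simp only [vx, pnorm_reflect]
  ring

/-- Half-plane second angular moment of the linearized Fermi–Dirac distribution. -/
lemma setIntegral_LFD_mul_cos_sq {β vF h : ℝ} (hβ : 0 < β) (hvF : 0 < vF) (hh : 0 < h) (A : ℝ) :
    ∫ p in {p : ℝ × ℝ | 0 < p.1}, LFD β vF h A p * (p.1 / pnorm p) ^ 2 = h ^ 2 / 4 := by
  have h1 := integral_eq_setIntegral_add_reflect (integrable_LFD_mul_cos_sq hβ hvF hh A)
  rw [integral_LFD_mul_cos_sq hβ hvF hh] at h1
  have h2 : ∀ p : ℝ × ℝ, LFD β vF h A p * (p.1 / pnorm p) ^ 2 +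
      LFD β vF h A (-p.1, p.2) * (-p.1 / pnorm (-p.1, p.2)) ^ 2 =
      2 * (LFD β vF h A p * (p.1 / pnorm p) ^ 2) := by
    intro p
    rw [LFD_reflect, pnorm_reflect]
    ring
  simp only [h2] at h1
  rw [integral_const_mul] at h1
  linarith

/-- Marshak-approximation derivation of the diffusive transmission condition (δV = 0):
the albedo ansatz together with the transmission condition forces
`ρ² − ρ¹ = (j/τ)·ϑ` where `ϑ` is the interpolation coefficient. -/
theorem stmt0 (β vF h : ℝ) (hβ : 0 < β) (hvF : 0 < vF) (hh : 0 < h)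
    (τ j ρ1 ρ2 A : ℝ) (hτ : 0 < τ)
    (T : ℝ × ℝ → ℝ) (hTmeas : Measurable T) (hT01 : ∀ p, T p ∈ Set.Icc (0 : ℝ) 1)
    (hTsym : ∀ p : ℝ × ℝ, T (-p.1, p.2) = T p)
    (θ1 θ2 : ℝ × ℝ → ℝ) (hθ1m : Measurable θ1) (hθ2m : Measurable θ2)
    (hi1 : Integrable (fun p => vx vF p * θ1 p))
    (hi2 : Integrable (fun p => vx vF p * θ2 p))
    (hi3 : Integrable (fun p => (vx vF p) ^ 2 * θ1 p))
    (halb1 : ∀ p : ℝ × ℝ, 0 < p.1 → θ1 p = ρ1 * LFD β vF h A p)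
    (halb2 : ∀ p : ℝ × ℝ, p.1 < 0 → θ2 p = ρ2 * LFD β vF h A p)
    (hflux1 : ∫ p : ℝ × ℝ, vx vF p * θ1 p = 0)
    (hflux2 : ∫ p : ℝ × ℝ, vx vF p * θ2 p = 0)
    (hTC : ∀ᵐ p : ℝ × ℝ, p.1 < 0 →
      θ1 p - Gfun β vF h τ j A p =
        (1 - T p) * (θ1 (-p.1, p.2) - Gfun β vF h τ j A (-p.1, p.2))
          + T p * (θ2 p - Gfun β vF h τ j A p))
    (hden : (∫ p in {p : ℝ × ℝ | 0 < p.1}, T p * LFD β vF h A p * vx vF p) ≠ 0) :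
    ρ2 - ρ1 = (j / τ) * ((2 / vF) *
      ((h ^ 2 / 2
          - 2 * ∫ p in {p : ℝ × ℝ | 0 < p.1}, T p * LFD β vF h A p * (p.1 / pnorm p) ^ 2)
        / (∫ p in {p : ℝ × ℝ | 0 < p.1}, T p * LFD β vF h A p * (p.1 / pnorm p)))) := by
  set S : Set (ℝ × ℝ) := {p | 0 < p.1} with hS
  have hSm : MeasurableSet S := measurableSet_right_half
  have hvx : ∀ p : ℝ × ℝ, vx vF p = vF * (p.1 / pnorm p) := fun p => by
    rw [vx, mul_div_assoc]
  have hI1 : IntegrableOn (fun p => T p * LFD β vF h A p * vx vF p) S :=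
    Integrable.of_integral_ne_zero hden
  have hK : IntegrableOn (fun p => LFD β vF h A p * (p.1 / pnorm p) ^ 2) S :=
    (integrable_LFD_mul_cos_sq hβ hvF hh A).integrableOn
  have hI2 : IntegrableOn (fun p => T p * LFD β vF h A p * (p.1 / pnorm p) ^ 2) S := by
    have := hK.bdd_mul (c := 1) hTmeas.aestronglyMeasurable
      (Eventually.of_forall fun p => by
        rw [norm_eq_abs, abs_of_nonneg (hT01 p).1]; exact (hT01 p).2)
    simpa only [mul_assoc, IntegrableOn] using this
  have hD : ∫ p in S, T p * LFD β vF h A p * vx vF p =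
      vF * ∫ p in S, T p * LFD β vF h A p * (p.1 / pnorm p) := by
    rw [← integral_const_mul]
    congr 1
    ext p
    rw [hvx]
    ring
  have hTC' : ∀ᵐ p : ℝ × ℝ, 0 < p.1 →
      vx vF p * θ1 p + vx vF (-p.1, p.2) * θ1 (-p.1, p.2) =
        (-(ρ2 - ρ1)) * (T p * LFD β vF h A p * vx vF p) +
          (4 * j / τ) * (LFD β vF h A p * (p.1 / pnorm p) ^ 2 -
            T p * LFD β vF h A p * (p.1 / pnorm p) ^ 2) := by
    filter_upwards [measurePreserving_reflect.quasiMeasurePreserving.ae hTC] with p hp hpos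
    have hneg : -p.1 < 0 := by linarith
    have h1 := hp hneg
    simp only [neg_neg, Prod.mk.eta, hTsym p, Gfun, vx_reflect, LFD_reflect, halb1 p hpos,
      halb2 (-p.1, p.2) hneg] at h1
    have h2 : θ1 (-p.1, p.2) = ρ1 * LFD β vF h A p + T p * (ρ2 - ρ1) * LFD β vF h A p -
        2 * (1 - T p) * ((2 / (τ * vF ^ 2)) * LFD β vF h A p * vx vF p * j) := by
      linear_combination h1
    rw [vx_reflect, halb1 p hpos, h2, hvx]
    generalize p.1 / pnorm p = c
    field_simp
    ring
  have hdiff : IntegrableOn (fun p => LFD β vF h A p * (p.1 / pnorm p) ^ 2 -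
      T p * LFD β vF h A p * (p.1 / pnorm p) ^ 2) S := hK.sub hI2
  have hfold := integral_eq_setIntegral_add_reflect hi1
  rw [hflux1, setIntegral_congr_ae hSm hTC',
    integral_add (hI1.const_mul _) (hdiff.const_mul _), integral_const_mul,
    integral_const_mul, integral_sub hK hI2, setIntegral_LFD_mul_cos_sq hβ hvF hh, hD] at hfold
  rw [hD] at hden
  have hden' := right_ne_zero_of_mul hden
  set I1 := ∫ p in S, T p * LFD β vF h A p * (p.1 / pnorm p)
  set I2 := ∫ p in S, T p * LFD β vF h A p * (p.1 / pnorm p) ^ 2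
  have hmul : (ρ2 - ρ1) * (vF * I1) = (4 * j / τ) * (h ^ 2 / 4 - I2) := by linarith
  rw [eq_div_of_mul_eq hden hmul]
  field_simp
  ring
end
end

section
/- Let a > 0. Define Ω = {p ∈ ℝ² : p_x > 0}, Ω′ = {p ∈ ℝ² : p_x > 0 and |p| > |p_y| + a}, and Φ : Ω → ℝ² by Φ(p) = ( √((|p| + a)² − p_y²), p_y ). Then Φ is a bijection from Ω onto Ω′, and for every f : ℝ² → ℝ such that p ↦ f(p)(p_x/|p|) is integrable on Ω′, one has ∫_Ω f(Φ(p)) (p_x/|p|) dp = ∫_{Ω′} f(p) (p_x/|p|) dp. -/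
open MeasureTheory Real Set Filter

noncomputable section

lemma pnorm_sq (p : ℝ × ℝ) : pnorm p ^ 2 = p.1 ^ 2 + p.2 ^ 2 :=
  Real.sq_sqrt (by positivity)

lemma pnorm_nonneg (p : ℝ × ℝ) : 0 ≤ pnorm p := Real.sqrt_nonneg _

lemma abs_snd_lt_pnorm {p : ℝ × ℝ} (hp : 0 < p.1) : |p.2| < pnorm p := by
  refine abs_lt_of_sq_lt_sq ?_ (pnorm_nonneg p)
  rw [pnorm_sq]
  nlinarith

lemma pnorm_sqrt_sq_sub_sq {c y : ℝ} (hc : 0 ≤ c) (h : 0 ≤ c ^ 2 - y ^ 2) :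
    pnorm (Real.sqrt (c ^ 2 - y ^ 2), y) = c := by
  rw [pnorm, Real.sq_sqrt h, sub_add_cancel, Real.sqrt_sq hc]

/-- The map shifting the norm of a momentum by `a` at fixed second component. -/
def energyShift (a : ℝ) (p : ℝ × ℝ) : ℝ × ℝ :=
  (Real.sqrt ((pnorm p + a) ^ 2 - p.2 ^ 2), p.2)

lemma sq_pnorm_add_sub_sq_snd_pos {a : ℝ} (ha : 0 ≤ a) {p : ℝ × ℝ} (hp : 0 < p.1) :
    0 < (pnorm p + a) ^ 2 - p.2 ^ 2 := by
  have h := pnorm_sq p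
  have h' := pnorm_nonneg p
  nlinarith [mul_nonneg h' ha]

lemma pnorm_energyShift {a : ℝ} (ha : 0 ≤ a) {p : ℝ × ℝ} (hp : 0 < p.1) :
    pnorm (energyShift a p) = pnorm p + a :=
  pnorm_sqrt_sq_sub_sq (add_nonneg (pnorm_nonneg p) ha) (sq_pnorm_add_sub_sq_snd_pos ha hp).le

lemma bijOn_energyShift {a : ℝ} (ha : 0 ≤ a) :
    Set.BijOn (energyShift a) {p : ℝ × ℝ | 0 < p.1}
      {p : ℝ × ℝ | 0 < p.1 ∧ |p.2| + a < pnorm p} := by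
  refine ⟨fun p hp => ⟨Real.sqrt_pos.mpr (sq_pnorm_add_sub_sq_snd_pos ha hp), ?_⟩,
    fun p hp q hq h => ?_, fun q hq => ?_⟩
  · rw [pnorm_energyShift ha hp]
    exact add_lt_add_left (abs_snd_lt_pnorm hp) a
  · have hpq : p.2 = q.2 := (Prod.ext_iff.mp h).2
    have hn : pnorm p = pnorm q := by
      have := congrArg pnorm h
      rw [pnorm_energyShift ha hp, pnorm_energyShift ha hq] at this
      linarith
    have h1 := pnorm_sq p
    rw [hn, pnorm_sq q, hpq] at h1
    exact Prod.ext ((sq_eq_sq₀ (le_of_lt hp) (le_of_lt hq)).mp (by linarith)) hpq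
  · obtain ⟨hq1, hq2⟩ := hq
    have hb := abs_nonneg q.2
    have hpos : 0 < (pnorm q - a) ^ 2 - q.2 ^ 2 := by
      rw [← sq_abs q.2]
      nlinarith
    have hn : pnorm (Real.sqrt ((pnorm q - a) ^ 2 - q.2 ^ 2), q.2) = pnorm q - a :=
      pnorm_sqrt_sq_sub_sq (by linarith) hpos.le
    refine ⟨(Real.sqrt ((pnorm q - a) ^ 2 - q.2 ^ 2), q.2), Real.sqrt_pos.mpr hpos, ?_⟩
    refine Prod.ext ?_ rfl
    simp only [energyShift, hn, sub_add_cancel, pnorm_sq, add_sub_cancel_right]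
    exact Real.sqrt_sq hq1.le

lemma det_prod_snd (A : ℝ × ℝ →L[ℝ] ℝ) :
    (A.prod (ContinuousLinearMap.snd ℝ ℝ ℝ)).det = A (1, 0) := by
  rw [ContinuousLinearMap.det, ← LinearMap.det_toMatrix (Module.Basis.finTwoProd ℝ),
    Matrix.det_fin_two]
  simp [LinearMap.toMatrix_apply]

lemma exists_hasFDerivAt_energyShift {a : ℝ} (ha : 0 ≤ a) {p : ℝ × ℝ} (hp : 0 < p.1) :
    ∃ L : ℝ × ℝ →L[ℝ] ℝ × ℝ, HasFDerivAt (energyShift a) L p ∧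
      L.det = (pnorm p + a) / (energyShift a p).1 * (p.1 / pnorm p) := by
  have hr : p.1 ^ 2 + p.2 ^ 2 ≠ 0 := by positivity
  have hn : HasFDerivAt pnorm _ p :=
    (((hasFDerivAt_fst (𝕜 := ℝ) (p := p)).pow 2).add
      ((hasFDerivAt_snd (𝕜 := ℝ) (p := p)).pow 2)).sqrt hr
  have hx := (((hn.add_const a).pow 2).sub
    ((hasFDerivAt_snd (𝕜 := ℝ) (p := p)).pow 2)).sqrt (sq_pnorm_add_sub_sq_snd_pos ha hp).ne'
  refine ⟨_, hx.prodMk hasFDerivAt_snd, ?_⟩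
  rw [det_prod_snd]
  have h0 : pnorm p ≠ 0 := ((abs_nonneg _).trans_lt (abs_snd_lt_pnorm hp)).ne'
  have h1 : (energyShift a p).1 ≠ 0 :=
    (Real.sqrt_pos.mpr (sq_pnorm_add_sub_sq_snd_pos ha hp)).ne'
  have e0 : Real.sqrt (p.1 ^ 2 + p.2 ^ 2) = pnorm p := rfl
  have e1 : Real.sqrt ((pnorm p + a) ^ 2 - p.2 ^ 2) = (energyShift a p).1 := rfl
  simp [e0, e1]
  field_simp

/-- The energy-shift map `Φ(p) = (√((|p|+a)² − p_y²), p_y)` is a bijection from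
`{p_x > 0}` onto `{p_x > 0, |p| > |p_y| + a}` and preserves the flux measure `(p_x/|p|) dp`. -/
theorem stmt2 (a : ℝ) (ha : 0 < a) :
    Set.BijOn (fun p : ℝ × ℝ => ((Real.sqrt ((pnorm p + a) ^ 2 - p.2 ^ 2), p.2) : ℝ × ℝ))
      {p : ℝ × ℝ | 0 < p.1} {p : ℝ × ℝ | 0 < p.1 ∧ |p.2| + a < pnorm p} ∧
    ∀ f : ℝ × ℝ → ℝ,
      IntegrableOn (fun p => f p * (p.1 / pnorm p))
        {p : ℝ × ℝ | 0 < p.1 ∧ |p.2| + a < pnorm p} →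
      ∫ p in {p : ℝ × ℝ | 0 < p.1},
          f (Real.sqrt ((pnorm p + a) ^ 2 - p.2 ^ 2), p.2) * (p.1 / pnorm p)
        = ∫ p in {p : ℝ × ℝ | 0 < p.1 ∧ |p.2| + a < pnorm p}, f p * (p.1 / pnorm p) := by
  refine ⟨bijOn_energyShift ha.le, fun f _ => ?_⟩
  have hbij := bijOn_energyShift ha.le
  choose! L hL hdet using fun (p : ℝ × ℝ) (hp : 0 < p.1) =>
    exists_hasFDerivAt_energyShift ha.le hp
  have hs : MeasurableSet {p : ℝ × ℝ | 0 < p.1} :=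
    measurableSet_lt measurable_const measurable_fst
  rw [← hbij.image_eq, integral_image_eq_integral_abs_det_fderiv_smul volume hs
    (fun p hp => (hL p hp).hasFDerivWithinAt) hbij.injOn]
  refine setIntegral_congr_fun hs fun p hp => ?_
  have hr : 0 < pnorm p := (abs_nonneg _).trans_lt (abs_snd_lt_pnorm hp)
  have hx : 0 < (energyShift a p).1 := (hbij.mapsTo hp).1
  have hp' : 0 < p.1 := hp
  simp only [hdet p hp, pnorm_energyShift ha.le hp, smul_eq_mul]
  rw [abs_of_nonneg (by positivity)]
  change f (energyShift a p) * _ = _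
  field_simp
end
end

section
/- Let A¹, A² ∈ ℝ, s, s′ ∈ {−1, +1} and δ ∈ ℝ satisfy s A¹ − s′ A² = −δ. If p, p′ ∈ ℝ² satisfy the conservation of energy s v_F|p| = s′ v_F|p′| − δ, then (1/φ₁(βA²)) L_{A¹}(p) = (1/φ₁(βA¹)) L_{A²}(p′). -/
open MeasureTheory Real Set Filter

noncomputable section

/-- The derivative `eˣ / (eˣ + 1)²` of the logistic function is even. -/
theorem fermi_weight_neg (x : ℝ) :
    (1 / (exp (-x) + 1)) ^ 2 * exp (-x) = (1 / (exp x + 1)) ^ 2 * exp x := by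
  have hx := exp_pos x
  rw [exp_neg]
  field_simp
  ring

/-- The identity `α_{A²} L_{A¹}(p) = α_{A¹} L_{A²}(p′)` across a potential drop `δ`,
where `α_A = 1/φ₁(βA)`, under `sA¹ − s′A² = −δ` and conservation of energy. -/
theorem stmt3 (β vF h : ℝ) (hβ : 0 < β) (hvF : 0 < vF) (hh : 0 < h)
    (A1 A2 δ s s' : ℝ) (hs : s = 1 ∨ s = -1) (hs' : s' = 1 ∨ s' = -1)
    (hA : s * A1 - s' * A2 = -δ)
    (p p' : ℝ × ℝ)
    (hE : s * (vF * pnorm p) = s' * (vF * pnorm p') - δ) :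
    (1 / fermiInt 1 (β * A2)) * LFD β vF h A1 p
      = (1 / fermiInt 1 (β * A1)) * LFD β vF h A2 p' := by
  have key : FD β vF A1 p ^ 2 * exp (β * (vF * pnorm p - A1))
      = FD β vF A2 p' ^ 2 * exp (β * (vF * pnorm p' - A2)) := by
    have hsq : s * (vF * pnorm p - A1) = s' * (vF * pnorm p' - A2) := by linarith
    have hxy : vF * pnorm p - A1 = vF * pnorm p' - A2 ∨
        vF * pnorm p - A1 = -(vF * pnorm p' - A2) := by
      rcases hs with rfl | rfl <;> rcases hs' with rfl | rfl
      · left; linarith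
      · right; linarith
      · right; linarith
      · left; linarith
    unfold FD
    rcases hxy with hx | hx
    · rw [hx]
    · rw [hx, mul_neg]
      exact fermi_weight_neg _
  unfold LFD
  rw [key, div_mul_div_comm, div_mul_div_comm]
  congr 1
  ring
end
end

section
/- For every A ∈ ℝ, the integral of the Fermi–Dirac distribution over momentum space gives the density–chemical-potential relation (1/h²) ∫_{ℝ²} 1/(e^{β(v_F|p| − A)} + 1) dp = n₀ φ₂(βA), where n₀ = 2π/(β h v_F)². -/
open MeasureTheory Real Set Filter

noncomputable section

/-- Density–chemical-potential relation: `(1/h²) ∫ F_A dp = n₀ φ₂(βA)`. -/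
theorem stmt6 (β vF h : ℝ) (hβ : 0 < β) (hvF : 0 < vF) (hh : 0 < h) (A : ℝ) :
    (1 / h ^ 2) * ∫ p : ℝ × ℝ, 1 / (Real.exp (β * (vF * pnorm p - A)) + 1)
      = n0 β vF h * fermiInt 2 (β * A) := by
  have hpolar : ∀ q ∈ polarCoord.target, pnorm (polarCoord.symm q) = q.1 := by
    rintro ⟨r, θ⟩ hq
    simp only [polarCoord_target, mem_prod, mem_Ioi] at hq
    rw [pnorm, polarCoord_symm_apply, Real.sqrt_eq_iff_mul_self_eq_of_pos hq.1]
    linear_combination -r ^ 2 * Real.sin_sq_add_cos_sq θ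
  have hrad : ∫ p : ℝ × ℝ, 1 / (Real.exp (β * (vF * pnorm p - A)) + 1)
      = (∫ r in Ioi (0 : ℝ), r / (Real.exp (β * vF * r - β * A) + 1)) * (2 * π) := by
    have hangle : ∫ _ in Ioo (-π) π, (1 : ℝ) = 2 * π := by
      simp [Real.pi_pos.le, two_mul]
    rw [← integral_comp_polarCoord_symm, ← hangle, ← setIntegral_prod_mul,
      ← polarCoord_target, ← Measure.volume_eq_prod]
    refine setIntegral_congr_fun polarCoord.open_target.measurableSet fun q hq => ?_
    simp only [smul_eq_mul, hpolar q hq, mul_one, mul_one_div]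
    ring_nf
  have hscale := integral_comp_mul_left_Ioi
    (fun t => t / (Real.exp (t - β * A) + 1)) 0 (mul_pos hβ hvF)
  simp only [mul_zero, mul_div_assoc, integral_const_mul, smul_eq_mul] at hscale
  have hfermi : fermiInt 2 (β * A)
      = ∫ t in Ioi (0 : ℝ), t / (Real.exp (t - β * A) + 1) := by
    norm_num [fermiInt, Real.Gamma_two]
  rw [hrad, n0, hfermi]
  field_simp at hscale ⊢
  linear_combination hscale
end
end

section
/- For every real k > 1, the Fermi integral φ_k is differentiable on ℝ and φ_k′(z) = φ_{k−1}(z) for all z ∈ ℝ. -/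
open MeasureTheory Real Set Filter

noncomputable section

theorem inv_exp_sub_add_one_le (t w : ℝ) :
    (Real.exp (t - w) + 1)⁻¹ ≤ Real.exp w * Real.exp (-t) := by
  rw [← Real.exp_add, show w + -t = -(t - w) by ring, Real.exp_neg]
  exact inv_anti₀ (Real.exp_pos _) (by linarith)

theorem exp_sub_div_sq_le (t w : ℝ) :
    Real.exp (t - w) / (Real.exp (t - w) + 1) ^ 2 ≤ Real.exp w * Real.exp (-t) := by
  refine le_trans ?_ (inv_exp_sub_add_one_le t w)
  have h := Real.exp_pos (t - w)
  rw [div_le_iff₀ (by positivity), sq, inv_mul_cancel_left₀ (by positivity)]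
  linarith

theorem integrableOn_rpow_mul_of_le_exp_neg {s C : ℝ} (hs : 0 < s) {g : ℝ → ℝ}
    (hg : Measurable g) (hg0 : ∀ t, 0 ≤ g t) (hgC : ∀ t, g t ≤ C * Real.exp (-t)) :
    IntegrableOn (fun t : ℝ => t ^ (s - 1) * g t) (Ioi 0) := by
  refine Integrable.mono' ((Real.GammaIntegral_convergent hs).const_mul C)
    (Measurable.aestronglyMeasurable (by fun_prop)) ?_
  filter_upwards [ae_restrict_mem measurableSet_Ioi] with t ht
  have ht' : 0 ≤ t ^ (s - 1) := Real.rpow_nonneg (le_of_lt ht) _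
  rw [Real.norm_of_nonneg (mul_nonneg ht' (hg0 t))]
  calc t ^ (s - 1) * g t ≤ t ^ (s - 1) * (C * Real.exp (-t)) :=
        mul_le_mul_of_nonneg_left (hgC t) ht'
    _ = C * (Real.exp (-t) * t ^ (s - 1)) := by ring

theorem integrableOn_fermi {s : ℝ} (hs : 0 < s) (w : ℝ) :
    IntegrableOn (fun t : ℝ => t ^ (s - 1) / (Real.exp (t - w) + 1)) (Ioi 0) :=
  integrableOn_rpow_mul_of_le_exp_neg hs (g := fun t => (Real.exp (t - w) + 1)⁻¹)
    (by fun_prop) (fun t => by positivity) (fun t => inv_exp_sub_add_one_le t w)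

theorem integrableOn_fermi_deriv {s : ℝ} (hs : 0 < s) (w : ℝ) :
    IntegrableOn (fun t : ℝ => t ^ (s - 1) *
      (Real.exp (t - w) / (Real.exp (t - w) + 1) ^ 2)) (Ioi 0) :=
  integrableOn_rpow_mul_of_le_exp_neg hs (by fun_prop) (fun t => by positivity)
    (fun t => exp_sub_div_sq_le t w)

theorem hasDerivAt_integral_fermi {k : ℝ} (hk : 0 < k) (z : ℝ) :
    HasDerivAt (fun w => ∫ t in Ioi (0 : ℝ), t ^ (k - 1) / (Real.exp (t - w) + 1))
      (∫ t in Ioi (0 : ℝ), t ^ (k - 1) *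
        (Real.exp (t - z) / (Real.exp (t - z) + 1) ^ 2)) z := by
  refine (hasDerivAt_integral_of_dominated_loc_of_deriv_le
    (F := fun w t => t ^ (k - 1) / (Real.exp (t - w) + 1))
    (F' := fun w t => t ^ (k - 1) * (Real.exp (t - w) / (Real.exp (t - w) + 1) ^ 2))
    (bound := fun t => Real.exp (z + 1) * (Real.exp (-t) * t ^ (k - 1)))
    (Iio_mem_nhds (lt_add_one z)) ?_ (integrableOn_fermi hk z)
    (integrableOn_fermi_deriv hk z).aestronglyMeasurable ?_
    ((Real.GammaIntegral_convergent hk).const_mul _) ?_).2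
  · exact Eventually.of_forall fun w => (integrableOn_fermi hk w).aestronglyMeasurable
  · filter_upwards [ae_restrict_mem measurableSet_Ioi] with t ht w hw
    have ht' : 0 ≤ t ^ (k - 1) := Real.rpow_nonneg (le_of_lt ht) _
    rw [Real.norm_of_nonneg (by positivity)]
    calc t ^ (k - 1) * (Real.exp (t - w) / (Real.exp (t - w) + 1) ^ 2)
        ≤ t ^ (k - 1) * (Real.exp (z + 1) * Real.exp (-t)) := by
          refine mul_le_mul_of_nonneg_left ((exp_sub_div_sq_le t w).trans ?_) ht'
          gcongr
          exact le_of_lt hw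
      _ = Real.exp (z + 1) * (Real.exp (-t) * t ^ (k - 1)) := by ring
  · refine Eventually.of_forall fun t w _ => ?_
    have h := (((hasDerivAt_id w).const_sub t).exp.add_const 1).inv
      (show Real.exp (t - w) + 1 ≠ 0 by positivity)
    exact (h.const_mul (t ^ (k - 1))).congr_deriv (by simp)

theorem integral_fermi_deriv {k : ℝ} (hk : 1 < k) (z : ℝ) :
    ∫ t in Ioi (0 : ℝ), t ^ (k - 1) * (Real.exp (t - z) / (Real.exp (t - z) + 1) ^ 2) =
      (k - 1) * ∫ t in Ioi (0 : ℝ), t ^ (k - 1 - 1) / (Real.exp (t - z) + 1) := by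
  have hk0 : 0 < k := by linarith
  have hk1 : 0 < k - 1 := by linarith
  have hi₁ := (integrableOn_fermi hk1 z).const_mul (k - 1)
  have hi₂ := integrableOn_fermi_deriv hk0 z
  have key := integral_Ioi_of_hasDerivAt_of_tendsto (a := 0) (m := 0)
    (f := fun t : ℝ => t ^ (k - 1) / (Real.exp (t - z) + 1))
    (f' := fun t => (k - 1) * (t ^ (k - 1 - 1) / (Real.exp (t - z) + 1)) -
      t ^ (k - 1) * (Real.exp (t - z) / (Real.exp (t - z) + 1) ^ 2))
    ?_ ?_ (Integrable.sub' hi₁ hi₂) ?_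
  · rw [integral_sub hi₁ hi₂, integral_const_mul, Real.zero_rpow hk1.ne', zero_div] at key
    linarith
  · refine ContinuousAt.continuousWithinAt (ContinuousAt.div ?_ (by fun_prop) (by positivity))
    exact Real.continuousAt_rpow_const _ _ (Or.inr hk1.le)
  · intro t ht
    have h₁ := Real.hasDerivAt_rpow_const (p := k - 1) (Or.inl (ne_of_gt ht))
    have h₂ := ((hasDerivAt_id t).sub_const z).exp.add_const 1
    have hpos : Real.exp (t - z) + 1 ≠ 0 := by positivity
    refine (h₁.div h₂ hpos).congr_deriv ?_
    simp only [id]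
    field_simp
  · have hlim := (tendsto_rpow_mul_exp_neg_mul_atTop_nhds_zero (k - 1) 1 one_pos).const_mul
      (Real.exp z)
    rw [mul_zero] at hlim
    refine squeeze_zero' ?_ ?_ hlim
    · filter_upwards [eventually_gt_atTop 0] with t ht
      positivity
    · filter_upwards [eventually_gt_atTop 0] with t ht
      have ht' : 0 ≤ t ^ (k - 1) := by positivity
      calc t ^ (k - 1) / (Real.exp (t - z) + 1)
          ≤ t ^ (k - 1) * (Real.exp z * Real.exp (-t)) :=
            mul_le_mul_of_nonneg_left (inv_exp_sub_add_one_le t z) ht'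
        _ = Real.exp z * (t ^ (k - 1) * Real.exp (-1 * t)) := by
            rw [neg_one_mul]; ring

/-- For `k > 1` the Fermi integral is differentiable with `φ_k′ = φ_{k−1}`. -/
theorem stmt9 (k : ℝ) (hk : 1 < k) (z : ℝ) :
    HasDerivAt (fun w => fermiInt k w) (fermiInt (k - 1) z) z := by
  have hk1 : k - 1 ≠ 0 := by linarith
  have h := (hasDerivAt_integral_fermi (by linarith : 0 < k) z).const_mul (1 / Real.Gamma k)
  have hG : Real.Gamma k = (k - 1) * Real.Gamma (k - 1) := by
    simpa using Real.Gamma_add_one hk1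
  have hG' : Real.Gamma (k - 1) ≠ 0 := (Real.Gamma_pos_of_pos (by linarith)).ne'
  unfold fermiInt
  refine h.congr_deriv ?_
  rw [integral_fermi_deriv hk, hG]
  field_simp
end
end

section
/- Let I ⊆ ℝ be an interval and let L : ℝ² → [0, ∞) be integrable with (1/h²) ∫_{ℝ²} L(p) dp = 1. Let θ : I × ℝ² → ℝ be such that θ(ξ, ·) is integrable for each ξ ∈ I, ξ ↦ θ(ξ, p) is differentiable for a.e. p, on each compact subinterval of I the functions |θ(ξ, ·)| and |∂_ξ θ(ξ, ·)| are dominated by a fixed integrable function, and the Milne equation v_x(p) ∂_ξ θ(ξ, p) = L(p) ⟨θ(ξ, ·)⟩ − θ(ξ, p) holds for all ξ ∈ I and a.e. p ∈ ℝ² \ {0}. Then the flux ξ ↦ ∫_{ℝ²} v_x(p) θ(ξ, p) dp is constant on I. -/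
open MeasureTheory Real Set Filter

noncomputable section

/-- A Carathéodory family (measurable in the parameter, continuous in time) over a compact interval
agrees, off a null set of parameters, with a jointly measurable function. -/
lemma exists_measurable_uncurry_ae_eq {Ω : Type*} [MeasurableSpace Ω] {μ : Measure Ω} {a b : ℝ}
    (hab : a ≤ b) {f : ℝ → Ω → ℝ} (hf : ∀ ξ ∈ Icc a b, AEMeasurable (f ξ) μ)
    (hcont : ∀ᵐ p ∂μ, ContinuousOn (fun ξ => f ξ p) (Icc a b)) :
    ∃ F : ℝ → Ω → ℝ, Measurable (Function.uncurry F) ∧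
      ∀ᵐ p ∂μ, ∀ ξ ∈ Icc a b, F ξ p = f ξ p := by
  let u : ℝ → Ω → ℝ := fun ξ p => f (projIcc a b hab ξ) p
  have hu : ∀ ξ, AEMeasurable (u ξ) μ := fun ξ => hf _ (projIcc a b hab ξ).2
  have hgood : ∀ᵐ p ∂μ, (Continuous fun ξ => u ξ p) ∧ ∀ q : ℚ, u q p = (hu q).mk (u q) p := by
    have hmk : ∀ᵐ p ∂μ, ∀ q : ℚ, u q p = (hu q).mk (u q) p :=
      ae_all_iff.2 fun q => (hu q).ae_eq_mk
    filter_upwards [hcont, hmk] with p hc hq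
    exact ⟨(continuousOn_iff_continuous_domRestrict.1 hc).comp continuous_projIcc, hq⟩
  obtain ⟨G, hGsub, hGmeas, hGnull⟩ := exists_measurable_superset_of_null (ae_iff.1 hgood)
  have hG : ∀ p, p ∉ G → (Continuous fun ξ => u ξ p) ∧ ∀ q : ℚ, u q p = (hu q).mk (u q) p :=
    fun p hp => by_contra fun hn => hp (hGsub hn)
  refine ⟨fun ξ => Gᶜ.indicator (u ξ), ?_, ?_⟩
  · refine (stronglyMeasurable_uncurry_of_continuous_of_stronglyMeasurable
      (u := fun ξ => Gᶜ.indicator (u ξ)) ?_ ?_).measurable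
    · intro p
      by_cases hp : p ∈ G
      · simpa [hp] using continuous_const
      · simpa [hp] using (hG p hp).1
    · intro ξ
      obtain ⟨x, hx, hxlim⟩ := mem_closure_iff_seq_limit.1 (Rat.denseRange_cast (𝕜 := ℝ) ξ)
      choose q hq using hx
      refine (measurable_of_tendsto_metrizable
        (f := fun n => Gᶜ.indicator ((hu (q n)).mk (u (q n)))) (fun n =>
          (hu (q n)).measurable_mk.indicator hGmeas.compl) ?_).stronglyMeasurable
      refine tendsto_pi_nhds.2 fun p => ?_
      by_cases hp : p ∈ G
      · simp [hp]
      · simp only [mem_compl_iff, hp, not_false_eq_true, indicator_of_mem]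
        simp_rw [← (hG p hp).2, hq]
        exact ((hG p hp).1.tendsto ξ).comp hxlim
  · filter_upwards [compl_mem_ae_iff.2 hGnull] with p hp ξ hξ
    simp only [indicator_of_mem hp, u, projIcc_of_mem hab hξ]

/-- Difference quotients give a jointly measurable version of the time derivative. -/
lemma exists_measurable_uncurry_deriv {Ω : Type*} [MeasurableSpace Ω] {F : ℝ → Ω → ℝ}
    (hF : Measurable (Function.uncurry F)) :
    ∃ D : ℝ → Ω → ℝ, Measurable (Function.uncurry D) ∧
      ∀ ξ p d, HasDerivAt (fun ζ => F ζ p) d ξ → D ξ p = d := by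
  let t : ℕ → ℝ := fun n => 1 / ((n : ℝ) + 1)
  refine ⟨fun ξ p => limsup (fun n => (t n)⁻¹ * (F (ξ + t n) p - F ξ p)) atTop, ?_, ?_⟩
  · refine Measurable.limsup fun n => ?_
    have hshift : Measurable fun z : ℝ × Ω => F (z.1 + t n) z.2 :=
      hF.comp ((measurable_fst.add_const _).prodMk measurable_snd)
    exact (hshift.sub hF).const_mul _
  · intro ξ p d hd
    have ht : Tendsto t atTop (nhdsWithin 0 {0}ᶜ) :=
      tendsto_nhdsWithin_iff.2 ⟨tendsto_one_div_add_atTop_nhds_zero_nat,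
        Eventually.of_forall fun n => (by positivity : (0 : ℝ) < t n).ne'⟩
    exact (hd.tendsto_slope_zero.comp ht).limsup_eq

lemma measurable_vx (vF : ℝ) : Measurable (vx vF) := by
  unfold vx pnorm
  fun_prop

lemma abs_vx_le (vF : ℝ) (p : ℝ × ℝ) : |vx vF p| ≤ |vF| := by
  have hp : |p.1| ≤ pnorm p := by
    rw [← Real.sqrt_sq_eq_abs]
    exact Real.sqrt_le_sqrt (by nlinarith [sq_nonneg p.2])
  rw [vx, abs_div, abs_mul, abs_of_nonneg ((abs_nonneg _).trans hp)]
  exact div_le_of_le_mul₀ ((abs_nonneg _).trans hp) (abs_nonneg _)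
    (mul_le_mul_of_nonneg_left hp (abs_nonneg _))

/-- Flux conservation for a mild form of the relaxation equation `w ∂_ξ f = L c ∫ f - f` with
`c ∫ L = 1`, on a compact interval. -/
lemma integral_mul_eq_of_relaxation {Ω : Type*} [MeasurableSpace Ω] {μ : Measure Ω} [SFinite μ]
    {a b c C : ℝ} (hab : a ≤ b) {L w g : Ω → ℝ} (hL : Integrable L μ)
    (hLnorm : c * ∫ p, L p ∂μ = 1) (hw : Measurable w) (hwC : ∀ p, |w p| ≤ C)
    {f f' : ℝ → Ω → ℝ} (hf : ∀ ξ ∈ Icc a b, Integrable (f ξ) μ)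
    (hderiv : ∀ᵐ p ∂μ, ∀ ξ ∈ Icc a b, HasDerivAt (fun ζ => f ζ p) (f' ξ p) ξ)
    (hg : Integrable g μ) (hfg : ∀ ξ ∈ Icc a b, ∀ᵐ p ∂μ, |f ξ p| ≤ g p)
    (heq : ∀ ξ ∈ Icc a b, ∀ᵐ p ∂μ, w p * f' ξ p = L p * (c * ∫ q, f ξ q ∂μ) - f ξ p) :
    ∫ p, w p * f a p ∂μ = ∫ p, w p * f b p ∂μ := by
  obtain ⟨F, hFm, hFf⟩ := exists_measurable_uncurry_ae_eq hab
    (fun ξ hξ => (hf ξ hξ).aemeasurable)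
    (hderiv.mono fun p hp ξ hξ => (hp ξ hξ).continuousAt.continuousWithinAt)
  obtain ⟨D, hDm, hD⟩ := exists_measurable_uncurry_deriv hFm
  have hDf' : ∀ᵐ p ∂μ, ∀ ξ ∈ Ioo a b, D ξ p = f' ξ p := by
    filter_upwards [hFf, hderiv] with p hp hd ξ hξ
    refine hD ξ p _ ((hd ξ (Ioo_subset_Icc_self hξ)).congr_of_eventuallyEq ?_)
    filter_upwards [Ioo_mem_nhds hξ.1 hξ.2] with ζ hζ using hp ζ (Ioo_subset_Icc_self hζ)
  have hFξ : ∀ ξ ∈ Icc a b, F ξ =ᵐ[μ] f ξ := fun ξ hξ => hFf.mono fun p hp => hp ξ hξ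
  let ν : Measure ℝ := volume.restrict (Ioo a b)
  have hν : ∀ᵐ ξ ∂ν, ξ ∈ Ioo a b := ae_restrict_mem measurableSet_Ioo
  have hFint : Integrable (Function.uncurry F) (ν.prod μ) := by
    refine (integrable_prod_iff hFm.aestronglyMeasurable).2 ⟨?_, ?_⟩
    · filter_upwards [hν] with ξ hξ
      exact (hf ξ (Ioo_subset_Icc_self hξ)).congr (hFξ ξ (Ioo_subset_Icc_self hξ)).symm
    · refine Integrable.of_bound
        hFm.stronglyMeasurable.norm.integral_prod_right'.aestronglyMeasurable (∫ p, g p ∂μ) ?_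
      filter_upwards [hν] with ξ hξ
      rw [Real.norm_of_nonneg (integral_nonneg fun _ => norm_nonneg _)]
      refine integral_mono_of_nonneg (Eventually.of_forall fun _ => norm_nonneg _) hg ?_
      filter_upwards [hFξ ξ (Ioo_subset_Icc_self hξ), hfg ξ (Ioo_subset_Icc_self hξ)] with p h1 h2
      simpa [Function.uncurry, h1] using h2
  let M : Ω → ℝ := hL.aemeasurable.mk L
  have hLM : L =ᵐ[μ] M := hL.aemeasurable.ae_eq_mk
  have hMm : Measurable M := hL.aemeasurable.measurable_mk
  let R : ℝ → Ω → ℝ := fun ξ p => M p * (c * ∫ q, F ξ q ∂μ) - F ξ p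
  have hρm : Measurable fun ξ => ∫ q, F ξ q ∂μ :=
    hFm.stronglyMeasurable.integral_prod_right.measurable
  have hRm : Measurable (Function.uncurry R) :=
    ((hMm.comp measurable_snd).mul ((hρm.comp measurable_fst).const_mul c)).sub hFm
  have hRint : Integrable (Function.uncurry R) (ν.prod μ) := by
    refine Integrable.sub ?_ hFint
    exact ((hFint.integral_prod_left.const_mul c).mul_prod (hL.congr hLM)).congr
      (Eventually.of_forall fun z => mul_comm _ _)
  have hRf : ∀ ξ ∈ Icc a b, ∀ᵐ p ∂μ, w p * f' ξ p = R ξ p := by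
    intro ξ hξ
    filter_upwards [heq ξ hξ, hFξ ξ hξ, hLM] with p h1 h2 h3
    simp only [R, h1, h2, h3, integral_congr_ae (hFξ ξ hξ)]
  have hwD : ∀ᵐ p ∂μ, ∀ᵐ ξ ∂ν, w p * D ξ p = R ξ p := by
    refine (Measure.ae_ae_comm (μ := ν) (ν := μ)
      (measurableSet_eq_fun ((hw.comp measurable_snd).mul hDm) hRm)).1 ?_
    filter_upwards [hν] with ξ hξ
    filter_upwards [hDf', hRf ξ (Ioo_subset_Icc_self hξ)] with p h1 h2
    rw [h1 ξ hξ, h2]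
  have hFTC : ∀ᵐ p ∂μ, w p * f b p - w p * f a p = ∫ ξ, R ξ p ∂ν := by
    filter_upwards [hwD, hDf', hderiv, hRint.prod_left_ae] with p h1 h2 h3 h4
    have h5 : (fun ξ => w p * f' ξ p) =ᵐ[ν] fun ξ => R ξ p := by
      filter_upwards [h1, hν] with ξ h h' using by rw [← h2 ξ h', h]
    have h6 : IntegrableOn (fun ξ => w p * f' ξ p) (Ioo a b) := h4.congr h5.symm
    rw [← integral_congr_ae h5, ← integral_Ioc_eq_integral_Ioo,
      ← intervalIntegral.integral_of_le hab]
    refine (intervalIntegral.integral_eq_sub_of_hasDerivAt (f := fun ξ => w p * f ξ p) ?_ ?_).symm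
    · rw [uIcc_of_le hab]
      exact fun ξ hξ => (h3 ξ hξ).const_mul _
    · rw [intervalIntegrable_iff_integrableOn_Ioo_of_le hab]
      exact h6
  have hzero : ∀ᵐ ξ ∂ν, ∫ p, R ξ p ∂μ = 0 := by
    filter_upwards [hFint.prod_right_ae] with ξ hξ
    replace hξ : Integrable (F ξ) μ := hξ
    have hM : ∫ p, M p ∂μ = ∫ p, L p ∂μ := integral_congr_ae hLM.symm
    change ∫ p, (M p * (c * ∫ q, F ξ q ∂μ) - F ξ p) ∂μ = 0
    rw [integral_sub ((hL.congr hLM).mul_const _) hξ, integral_mul_const, hM]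
    linear_combination (∫ q, F ξ q ∂μ) * hLnorm
  have hwf : ∀ ξ ∈ Icc a b, Integrable (fun p => w p * f ξ p) μ := fun ξ hξ =>
    (hf ξ hξ).bdd_mul hw.aestronglyMeasurable (Eventually.of_forall hwC)
  have hdiff : ∫ p, w p * f b p ∂μ - ∫ p, w p * f a p ∂μ = 0 := by
    rw [← integral_sub (hwf b (right_mem_Icc.2 hab)) (hwf a (left_mem_Icc.2 hab)),
      integral_congr_ae hFTC, ← integral_integral_swap hRint, integral_congr_ae hzero,
      integral_zero]
  linarith

/-- Any sufficiently regular solution of the Milne equation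
`v_x ∂_ξ θ = L ⟨θ⟩ − θ` on an interval has constant flux `ξ ↦ ∫ v_x θ(ξ,·) dp`. -/
theorem stmt15 (vF h : ℝ) (hvF : 0 < vF) (hh : 0 < h)
    (I : Set ℝ) (hI : I.OrdConnected)
    (L : ℝ × ℝ → ℝ) (hL0 : ∀ p, 0 ≤ L p) (hLint : Integrable L)
    (hLnorm : (1 / h ^ 2) * ∫ p : ℝ × ℝ, L p = 1)
    (θ Dθ : ℝ → ℝ × ℝ → ℝ)
    (hθint : ∀ ξ ∈ I, Integrable (θ ξ))
    (hderiv : ∀ᵐ p : ℝ × ℝ, ∀ ξ ∈ I, HasDerivAt (fun ζ => θ ζ p) (Dθ ξ p) ξ)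
    (hdom : ∀ a b : ℝ, Set.Icc a b ⊆ I → ∃ g : ℝ × ℝ → ℝ, Integrable g ∧
      ∀ ξ ∈ Set.Icc a b, ∀ᵐ p : ℝ × ℝ, |θ ξ p| ≤ g p ∧ |Dθ ξ p| ≤ g p)
    (hMilne : ∀ ξ ∈ I, ∀ᵐ p : ℝ × ℝ, p ≠ 0 →
      vx vF p * Dθ ξ p = L p * ((1 / h ^ 2) * ∫ q : ℝ × ℝ, θ ξ q) - θ ξ p) :
    ∀ ξ₁ ∈ I, ∀ ξ₂ ∈ I,
      ∫ p : ℝ × ℝ, vx vF p * θ ξ₁ p = ∫ p : ℝ × ℝ, vx vF p * θ ξ₂ p := by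
  have key : ∀ a ∈ I, ∀ b ∈ I, a ≤ b →
      ∫ p : ℝ × ℝ, vx vF p * θ a p = ∫ p : ℝ × ℝ, vx vF p * θ b p := by
    intro a ha b hb hab
    have hsub : Icc a b ⊆ I := hI.out ha hb
    obtain ⟨g, hg, hθg⟩ := hdom a b hsub
    refine integral_mul_eq_of_relaxation hab hLint hLnorm (measurable_vx vF) (abs_vx_le vF)
      (fun ξ hξ => hθint ξ (hsub hξ)) (hderiv.mono fun p hp ξ hξ => hp ξ (hsub hξ)) hg
      (fun ξ hξ => (hθg ξ hξ).mono fun p hp => hp.1) fun ξ hξ => ?_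
    filter_upwards [hMilne ξ (hsub hξ), Measure.ae_ne volume (0 : ℝ × ℝ)] with p hp h0 using hp h0
  intro a ha b hb
  rcases le_total a b with hab | hab
  · exact key a ha b hb hab
  · exact (key b hb a ha hab).symm
end
end
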